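/- Let 𝕂 be an additively idempotent ω-continuous commutative semiring, A a concept name, and O^𝕂 = D^𝕂 ∪ {(C_i ⊑ A, 1) | 1 ≤ i ≤ n} a 𝕂-annotated ELHI⊥ ontology, where D^𝕂 = ⟨D,λ⟩ consists of (concept and role) assertions and each C_i is an ELHI concept in which A does not occur. Then for every individual name a: P(A(a), O^𝕂) equals the ⊕-sum of the set {λ(A(a)) | if A(a) ∈ D} ∪ ⋃_{i=1}^{n} { ⊗_{P(t⃗) atom of q_{C_i}(a)} λ(P(π(t⃗))) | π ∈ Π(q_{C_i}(a), D) }, where ⊤-atoms contribute the factor 1. -/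

import Mathlib

namespace DLProv

/-! ### Syntax of ELHI⊥ -/

/-- A role: a role name or an inverse role. Role names are natural numbers. -/
inductive DLRole : Type
  | name : ℕ → DLRole
  | inv : ℕ → DLRole
deriving DecidableEq

/-- The underlying role name of a role. -/
def DLRole.base : DLRole → ℕ
  | .name R => R
  | .inv R => R

/-- The inverse of a role. -/
def DLRole.invr : DLRole → DLRole
  | .name R => .inv R
  | .inv R => .name R

/-- ELHI⊥ concepts (built from concept names, ⊤, ⊥, ⊓ and ∃P.C). -/
inductive DLConcept : Type
  | top : DLConcept
  | bot : DLConcept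
  | atom : ℕ → DLConcept
  | inter : DLConcept → DLConcept → DLConcept
  | exis : DLRole → DLConcept → DLConcept
deriving DecidableEq

namespace DLConcept

/-- ELHI concepts: those not mentioning ⊥. -/
def botFree : DLConcept → Prop
  | top => True
  | bot => False
  | atom _ => True
  | inter C D => C.botFree ∧ D.botFree
  | exis _ C => C.botFree

/-- Basic concepts: concept names and concepts of the form ∃P (= ∃P.⊤). -/
def isBasic (C : DLConcept) : Prop := (∃ A, C = atom A) ∨ ∃ P, C = exis P top

/-- Admissible right-hand sides of GCIs: ⊥, a concept name, or ∃P. -/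
def isRHS (C : DLConcept) : Prop := C = bot ∨ (∃ A, C = atom A) ∨ ∃ P, C = exis P top

/-- A concept name or ⊤. -/
def isAtomic (C : DLConcept) : Prop := C = top ∨ ∃ A, C = atom A

/-- Concept names occurring in a concept. -/
def concNames : DLConcept → Finset ℕ
  | top => ∅
  | bot => ∅
  | atom A => {A}
  | inter C D => C.concNames ∪ D.concNames
  | exis _ C => C.concNames

/-- Role names occurring in a concept. -/
def roleNames : DLConcept → Finset ℕ
  | top => ∅
  | bot => ∅
  | atom _ => ∅
  | inter C D => C.roleNames ∪ D.roleNames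
  | exis P C => insert P.base C.roleNames

end DLConcept

/-- ELHI⊥ axioms: concept assertions A(a), role assertions R(a,b),
role inclusions P ⊑ Q, negative role inclusions P ⊓ Q ⊑ ⊥, and GCIs C ⊑ D. -/
inductive DLAxiom : Type
  | cassert : ℕ → ℕ → DLAxiom
  | rassert : ℕ → ℕ → ℕ → DLAxiom
  | roleInc : DLRole → DLRole → DLAxiom
  | roleDisj : DLRole → DLRole → DLAxiom
  | gci : DLConcept → DLConcept → DLAxiom
deriving DecidableEq

namespace DLAxiom

/-- Well-formedness: the right-hand side of a GCI is ⊥, a concept name, or ∃P. -/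
def wf : DLAxiom → Prop
  | gci _ D => D.isRHS
  | _ => True

def isAssertion : DLAxiom → Prop
  | cassert _ _ => True
  | rassert _ _ _ => True
  | _ => False

def concNames : DLAxiom → Finset ℕ
  | cassert A _ => {A}
  | rassert _ _ _ => ∅
  | roleInc _ _ => ∅
  | roleDisj _ _ => ∅
  | gci C D => C.concNames ∪ D.concNames

def roleNames : DLAxiom → Finset ℕ
  | cassert _ _ => ∅
  | rassert R _ _ => {R}
  | roleInc P Q => {P.base, Q.base}
  | roleDisj P Q => {P.base, Q.base}
  | gci C D => C.roleNames ∪ D.roleNames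

def indNames : DLAxiom → Finset ℕ
  | cassert _ a => {a}
  | rassert _ a b => {a, b}
  | _ => ∅

/-- ⊥ does not occur in the axiom. -/
def botFree : DLAxiom → Prop
  | cassert _ _ => True
  | rassert _ _ _ => True
  | roleInc _ _ => True
  | roleDisj _ _ => False
  | gci C D => C.botFree ∧ D.botFree

/-- Normal form: every GCI is of one of the forms A₁ ⊓ A₂ ⊑ B, ∃P.A ⊑ B, or A ⊑ ∃P,
with A, A₁, A₂ ∈ N_C ∪ {⊤} and B ∈ N_C ∪ {⊥}. -/
def inNF : DLAxiom → Prop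
  | gci C D =>
      (∃ C₁ C₂, C = .inter C₁ C₂ ∧ C₁.isAtomic ∧ C₂.isAtomic ∧ (D = .bot ∨ ∃ B, D = .atom B)) ∨
      (∃ P C', C = .exis P C' ∧ C'.isAtomic ∧ (D = .bot ∨ ∃ B, D = .atom B)) ∨
      (C.isAtomic ∧ ∃ P, D = .exis P .top)
  | _ => True

end DLAxiom

/-! ### Annotated interpretations over a commutative semiring -/

/-- A 𝕂-annotated interpretation with domain `dom` inside the type `Δ`. -/
structure Interp (Δ : Type) (K : Type) where
  dom : Set Δ
  dom_nonempty : dom.Nonempty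
  indiv : ℕ → Δ
  indiv_mem : ∀ a, indiv a ∈ dom
  conc : ℕ → Set (Δ × K)
  conc_mem : ∀ A p, p ∈ conc A → p.1 ∈ dom
  role : ℕ → Set (Δ × Δ × K)
  role_mem : ∀ R p, p ∈ role R → p.1 ∈ dom ∧ p.2.1 ∈ dom

variable {Δ Δ' K : Type}

/-- Annotated extension of a role. -/
def DLRole.interp (I : Interp Δ K) : DLRole → Set (Δ × Δ × K)
  | .name R => I.role R
  | .inv R => {p | (p.2.1, p.1, p.2.2) ∈ I.role R}

/-- Annotated extension of a concept. -/
def DLConcept.interp [CommSemiring K] (I : Interp Δ K) : DLConcept → Set (Δ × K)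
  | .top => {p | p.1 ∈ I.dom ∧ p.2 = 1}
  | .bot => ∅
  | .atom A => I.conc A
  | .inter C D => {p | ∃ d κ₁ κ₂, (d, κ₁) ∈ DLConcept.interp I C ∧
      (d, κ₂) ∈ DLConcept.interp I D ∧ p = (d, κ₁ * κ₂)}
  | .exis P C => {p | ∃ d e κ₁ κ₂, (d, e, κ₁) ∈ DLRole.interp I P ∧
      (e, κ₂) ∈ DLConcept.interp I C ∧ p = (d, κ₁ * κ₂)}

/-- Satisfaction of an annotated axiom. -/
def Interp.satA [CommSemiring K] (I : Interp Δ K) : DLAxiom → K → Prop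
  | .cassert A a, κ => (I.indiv a, κ) ∈ I.conc A
  | .rassert R a b, κ => (I.indiv a, I.indiv b, κ) ∈ I.role R
  | .roleInc P Q, κ => ∀ d e κ', (d, e, κ') ∈ P.interp I → (d, e, κ * κ') ∈ Q.interp I
  | .roleDisj P Q, _ => ∀ d e κ₁ κ₂, (d, e, κ₁) ∈ P.interp I → (d, e, κ₂) ∈ Q.interp I → False
  | .gci C .bot, _ => C.interp I = ∅
  | .gci C D, κ => ∀ d κ', (d, κ') ∈ C.interp I → (d, κ * κ') ∈ D.interp I

/-! ### Conjunctive queries -/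

inductive DLTerm : Type
  | var : ℕ → DLTerm
  | ind : ℕ → DLTerm
deriving DecidableEq

/-- Query atoms: A(t) with A ∈ N_C ∪ {⊤}, or R(t,t') with R ∈ N_R. -/
inductive QAtom : Type
  | top : DLTerm → QAtom
  | conc : ℕ → DLTerm → QAtom
  | role : ℕ → DLTerm → DLTerm → QAtom
deriving DecidableEq

/-- A (Boolean) conjunctive query: a conjunction of atoms, all variables
existentially quantified. -/
abbrev BCQ := List QAtom

def Interp.tval (I : Interp Δ K) (π : ℕ → Δ) : DLTerm → Δ
  | .var v => π v
  | .ind a => I.indiv a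

/-- A match of the extended version of an atom, assigning value `κ` to its
annotation variable. -/
def QAtom.holds [CommSemiring K] (I : Interp Δ K) (π : ℕ → Δ) : QAtom → K → Prop
  | .top t, κ => I.tval π t ∈ I.dom ∧ κ = 1
  | .conc A t, κ => (I.tval π t, κ) ∈ I.conc A
  | .role R t t', κ => (I.tval π t, I.tval π t', κ) ∈ I.role R

/-- `I` satisfies the annotated BCQ (q, κ): some match of the extended version of `q`
gives κ as the product of the values of the annotation variables. -/
def Interp.satQ [CommSemiring K] (I : Interp Δ K) (q : BCQ) (κ : K) : Prop :=
  ∃ π : ℕ → Δ, (∀ v, π v ∈ I.dom) ∧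
    ∃ κs : List K, List.Forall₂ (fun a k => QAtom.holds I π a k) q κs ∧ κs.prod = κ

/-- A statement: an axiom or a BCQ. -/
inductive DLStmt : Type
  | ax : DLAxiom → DLStmt
  | query : BCQ → DLStmt

def Interp.satS [CommSemiring K] (I : Interp Δ K) : DLStmt → K → Prop
  | .ax α, κ => I.satA α κ
  | .query q, κ => I.satQ q κ

/-! ### Annotated ontologies, models and entailment -/

/-- The set of annotated axioms of the annotated ontology ⟨O, λ⟩. -/
def toAnn (O : Finset DLAxiom) (lam : DLAxiom → K) : Set (DLAxiom × K) :=
  {p | p.1 ∈ O ∧ p.2 = lam p.1}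

def isModel [CommSemiring K] (I : Interp Δ K) (Ω : Set (DLAxiom × K)) : Prop :=
  ∀ p ∈ Ω, I.satA p.1 p.2

/-- Satisfiability of a set of annotated axioms. -/
def AnnSat [CommSemiring K] (Ω : Set (DLAxiom × K)) : Prop :=
  ∃ (Δ : Type) (I : Interp Δ K), isModel I Ω

/-- Entailment of an annotated statement from a set of annotated axioms. -/
def Entails [CommSemiring K] (Ω : Set (DLAxiom × K)) (s : DLStmt) (κ : K) : Prop :=
  ∀ (Δ : Type) (I : Interp Δ K), isModel I Ω → I.satS s κ

/-! ### Non-annotated (plain) semantics -/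

structure PInterp (Δ : Type) where
  dom : Set Δ
  dom_nonempty : dom.Nonempty
  indiv : ℕ → Δ
  indiv_mem : ∀ a, indiv a ∈ dom
  conc : ℕ → Set Δ
  conc_mem : ∀ A d, d ∈ conc A → d ∈ dom
  role : ℕ → Set (Δ × Δ)
  role_mem : ∀ R p, p ∈ role R → p.1 ∈ dom ∧ p.2 ∈ dom

def DLRole.pinterp (I : PInterp Δ) : DLRole → Set (Δ × Δ)
  | .name R => I.role R
  | .inv R => {p | (p.2, p.1) ∈ I.role R}

def DLConcept.pinterp (I : PInterp Δ) : DLConcept → Set Δ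
  | .top => I.dom
  | .bot => ∅
  | .atom A => I.conc A
  | .inter C D => DLConcept.pinterp I C ∩ DLConcept.pinterp I D
  | .exis P C => {d | ∃ e, (d, e) ∈ DLRole.pinterp I P ∧ e ∈ DLConcept.pinterp I C}

def PInterp.satA (I : PInterp Δ) : DLAxiom → Prop
  | .cassert A a => I.indiv a ∈ I.conc A
  | .rassert R a b => (I.indiv a, I.indiv b) ∈ I.role R
  | .roleInc P Q => ∀ p ∈ P.pinterp I, p ∈ Q.pinterp I
  | .roleDisj P Q => ∀ p, p ∈ P.pinterp I → p ∈ Q.pinterp I → False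
  | .gci C D => C.pinterp I ⊆ D.pinterp I

def PInterp.tval (I : PInterp Δ) (π : ℕ → Δ) : DLTerm → Δ
  | .var v => π v
  | .ind a => I.indiv a

def QAtom.pholds (I : PInterp Δ) (π : ℕ → Δ) : QAtom → Prop
  | .top t => I.tval π t ∈ I.dom
  | .conc A t => I.tval π t ∈ I.conc A
  | .role R t t' => (I.tval π t, I.tval π t') ∈ I.role R

def PInterp.satQ (I : PInterp Δ) (q : BCQ) : Prop :=
  ∃ π : ℕ → Δ, (∀ v, π v ∈ I.dom) ∧ ∀ a ∈ q, QAtom.pholds I π a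

def PInterp.satS (I : PInterp Δ) : DLStmt → Prop
  | .ax α => I.satA α
  | .query q => I.satQ q

def isPModel (I : PInterp Δ) (O : Finset DLAxiom) : Prop := ∀ α ∈ O, I.satA α

def PSat (O : Finset DLAxiom) : Prop := ∃ (Δ : Type) (I : PInterp Δ), isPModel I O

def PEntails (O : Finset DLAxiom) (s : DLStmt) : Prop :=
  ∀ (Δ : Type) (I : PInterp Δ), isPModel I O → I.satS s

/-- A concept is satisfiable w.r.t. O if it has a nonempty extension in some model of O. -/
def CSat (O : Finset DLAxiom) (C : DLConcept) : Prop :=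
  ∃ (Δ : Type) (I : PInterp Δ), isPModel I O ∧ (C.pinterp I).Nonempty

/-- A role is satisfiable w.r.t. O if it has a nonempty extension in some model of O. -/
def RSat (O : Finset DLAxiom) (P : DLRole) : Prop :=
  ∃ (Δ : Type) (I : PInterp Δ), isPModel I O ∧ (P.pinterp I).Nonempty

/-- The plain interpretation obtained from an annotated one by dropping annotations. -/
def Interp.forget (I : Interp Δ K) : PInterp Δ where
  dom := I.dom
  dom_nonempty := I.dom_nonempty
  indiv := I.indiv
  indiv_mem := I.indiv_mem
  conc A := {d | ∃ κ, (d, κ) ∈ I.conc A}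
  conc_mem := fun A d hd => by obtain ⟨κ, hκ⟩ := hd; exact I.conc_mem A _ hκ
  role R := {p | ∃ κ, (p.1, p.2, κ) ∈ I.role R}
  role_mem := fun R p hp => by obtain ⟨κ, hκ⟩ := hp; exact I.role_mem R _ hκ

/-! ### ω-continuous commutative semirings and provenance -/

/-- The canonical preorder of a semiring: a ≤ b iff a ⊕ c = b for some c. -/
def canLE [Add K] (a b : K) : Prop := ∃ c, a + c = b

/-- The set of all sums of finite subsets of `S`. -/
def finSubsums [AddCommMonoid K] (S : Set K) : Set K :=
  {x | ∃ F : Finset K, ↑F ⊆ S ∧ F.sum id = x}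

/-- `u` is a least upper bound of `S` w.r.t. the canonical preorder. -/
def IsSupOf [Add K] (S : Set K) (u : K) : Prop :=
  (∀ a ∈ S, canLE a u) ∧ ∀ v, (∀ a ∈ S, canLE a v) → canLE u v

/-- ω-continuous commutative semirings: the canonical preorder is a partial order,
ω-chains have least upper bounds preserved by ⊕ and ⊗, and possibly infinite sums
are defined as suprema of finite subsums. -/
class OmegaCS (K : Type) extends CommSemiring K where
  canLE_antisymm : ∀ a b : K, canLE a b → canLE b a → a = b
  csup : (ℕ → K) → K
  csup_isSup : ∀ f : ℕ → K, (∀ n, canLE (f n) (f (n + 1))) → IsSupOf (Set.range f) (csup f)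
  add_csup : ∀ f : ℕ → K, (∀ n, canLE (f n) (f (n + 1))) →
      ∀ a : K, a + csup f = csup fun n => a + f n
  mul_csup : ∀ f : ℕ → K, (∀ n, canLE (f n) (f (n + 1))) →
      ∀ a : K, a * csup f = csup fun n => a * f n
  setSum : Set K → K
  setSum_isSup : ∀ S : Set K, IsSupOf (finSubsums S) (setSum S)

/-- The provenance of a statement w.r.t. a set of annotated axioms: the (possibly
infinite) sum of all κ such that (s, κ) is entailed. -/
def prov [OmegaCS K] (Ω : Set (DLAxiom × K)) (s : DLStmt) : K :=
  OmegaCS.setSum {κ | Entails Ω s κ}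

/-! ### Instance queries -/

/-- `qCt C t n` is the (body of) the instance query for the concept `C` with head
term `t`, using fresh variables starting from `n`; returns the query together with
the next fresh variable index. -/
def qCt : DLConcept → DLTerm → ℕ → BCQ × ℕ
  | .top, t, n => ([QAtom.top t], n)
  | .bot, t, n => ([QAtom.top t], n)
  | .atom A, t, n => ([QAtom.conc A t], n)
  | .inter C D, t, n =>
      let r₁ := qCt C t n
      let r₂ := qCt D t r₁.2
      (r₁.1 ++ r₂.1, r₂.2)
  | .exis (.name R) C, t, n =>
      let r := qCt C (.var n) (n + 1)
      (QAtom.role R t (.var n) :: r.1, r.2)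
  | .exis (.inv R) C, t, n =>
      let r := qCt C (.var n) (n + 1)
      (QAtom.role R (.var n) t :: r.1, r.2)

/-- The instance query q_C(a) for an individual name a. -/
def qCa (C : DLConcept) (a : ℕ) : BCQ := (qCt C (DLTerm.ind a) 0).1

/-! ### Database matches -/

def tvalN (σ : ℕ → ℕ) : DLTerm → ℕ
  | .var v => σ v
  | .ind a => a

def QAtom.dbHolds (O : Finset DLAxiom) (σ : ℕ → ℕ) : QAtom → Prop
  | .top _ => True
  | .conc A t => DLAxiom.cassert A (tvalN σ t) ∈ O
  | .role R t t' => DLAxiom.rassert R (tvalN σ t) (tvalN σ t') ∈ O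

/-- A database match of a BCQ in a set of assertions. -/
def isDBMatch (O : Finset DLAxiom) (σ : ℕ → ℕ) (q : BCQ) : Prop :=
  ∀ a ∈ q, QAtom.dbHolds O σ a

def QAtom.dbVal [CommSemiring K] (lam : DLAxiom → K) (σ : ℕ → ℕ) : QAtom → K
  | .top _ => 1
  | .conc A t => lam (DLAxiom.cassert A (tvalN σ t))
  | .role R t t' => lam (DLAxiom.rassert R (tvalN σ t) (tvalN σ t'))

/-- The ⊗-product, over the atoms of `q`, of the annotations of the matched facts. -/
def matchVal [CommSemiring K] (lam : DLAxiom → K) (σ : ℕ → ℕ) (q : BCQ) : K :=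
  (q.map (QAtom.dbVal lam σ)).prod

/-! ### Homomorphisms and canonical models -/

/-- Homomorphism between 𝕂-annotated interpretations. -/
def IsHom [CommSemiring K] (Ic : Interp Δ K) (I : Interp Δ' K) (g : Δ → Δ') : Prop :=
  Set.MapsTo g Ic.dom I.dom ∧ (∀ a, g (Ic.indiv a) = I.indiv a) ∧
  (∀ A d κ, (d, κ) ∈ Ic.conc A → (g d, κ) ∈ I.conc A) ∧
  (∀ R d e κ, (d, e, κ) ∈ Ic.role R → (g d, g e, κ) ∈ I.role R)

/-- Domain of canonical models: individual names (inl) plus fresh elements (inr). -/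
abbrev CD : Type := ℕ ⊕ ℕ

def baseConc (Ω : Set (DLAxiom × K)) (A : ℕ) : Set (CD × K) :=
  {p | ∃ a κ, (DLAxiom.cassert A a, κ) ∈ Ω ∧ p = (Sum.inl a, κ)}

def baseRole (Ω : Set (DLAxiom × K)) (R : ℕ) : Set (CD × CD × K) :=
  {p | ∃ a b κ, (DLAxiom.rassert R a b, κ) ∈ Ω ∧ p = (Sum.inl a, Sum.inl b, κ)}

/-- The initial interpretation I₀ of the canonical model construction. -/
def InitCan (Ω : Set (DLAxiom × K)) (I : Interp CD K) : Prop :=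
  I.dom = Set.range (Sum.inl : ℕ → CD) ∧ I.indiv = Sum.inl ∧
  (∀ A, I.conc A = baseConc Ω A) ∧ (∀ R, I.role R = baseRole Ω R)

/-- Where and how a tuple is inserted for the role `P`: the underlying role name
and the (suitably oriented) tuple. -/
def insRole (P : DLRole) (d e : CD) (κ : K) : ℕ × (CD × CD × K) :=
  match P with
  | .name R => (R, (d, e, κ))
  | .inv R => (R, (e, d, κ))

/-- One application of a rule of the canonical model construction. -/
def StepCan [CommSemiring K] (Ω : Set (DLAxiom × K)) (I J : Interp CD K) : Prop :=
  (∃ P Q κ d e κ', (DLAxiom.roleInc P Q, κ) ∈ Ω ∧ (d, e, κ') ∈ DLRole.interp I P ∧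
     J.dom = I.dom ∧ J.indiv = I.indiv ∧ (∀ A, J.conc A = I.conc A) ∧
     (∀ S, S ≠ (insRole Q d e (κ * κ')).1 → J.role S = I.role S) ∧
     J.role (insRole Q d e (κ * κ')).1 =
       insert (insRole Q d e (κ * κ')).2 (I.role (insRole Q d e (κ * κ')).1)) ∨
  (∃ C A κ d κ', (DLAxiom.gci C (DLConcept.atom A), κ) ∈ Ω ∧ (d, κ') ∈ DLConcept.interp I C ∧
     J.dom = I.dom ∧ J.indiv = I.indiv ∧ (∀ R, J.role R = I.role R) ∧
     (∀ B, B ≠ A → J.conc B = I.conc B) ∧ J.conc A = insert (d, κ * κ') (I.conc A)) ∨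
  (∃ C P κ d κ' df, (DLAxiom.gci C (DLConcept.exis P DLConcept.top), κ) ∈ Ω ∧
     (d, κ') ∈ DLConcept.interp I C ∧ df ∉ I.dom ∧
     J.dom = insert df I.dom ∧ J.indiv = I.indiv ∧ (∀ A, J.conc A = I.conc A) ∧
     (∀ S, S ≠ (insRole P d df (κ * κ')).1 → J.role S = I.role S) ∧
     J.role (insRole P d df (κ * κ')).1 =
       insert (insRole P d df (κ * κ')).2 (I.role (insRole P d df (κ * κ')).1))

/-- Fairness: every applicable rule instance has eventually been applied,
i.e. the limit is closed under the rules. -/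
def ClosedCan [CommSemiring K] (Ω : Set (DLAxiom × K)) (I : Interp CD K) : Prop :=
  (∀ P Q κ, (DLAxiom.roleInc P Q, κ) ∈ Ω →
      ∀ d e κ', (d, e, κ') ∈ DLRole.interp I P → (d, e, κ * κ') ∈ DLRole.interp I Q) ∧
  (∀ C A κ, (DLAxiom.gci C (DLConcept.atom A), κ) ∈ Ω →
      ∀ d κ', (d, κ') ∈ DLConcept.interp I C → (d, κ * κ') ∈ I.conc A) ∧
  (∀ C P κ, (DLAxiom.gci C (DLConcept.exis P DLConcept.top), κ) ∈ Ω →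
      ∀ d κ', (d, κ') ∈ DLConcept.interp I C → ∃ e, (d, e, κ * κ') ∈ DLRole.interp I P)

/-- `I` is the union of the increasing sequence `Iseq`. -/
def IsLimitOf (Iseq : ℕ → Interp CD K) (I : Interp CD K) : Prop :=
  I.dom = (⋃ n, (Iseq n).dom) ∧ I.indiv = (Iseq 0).indiv ∧
  (∀ A, I.conc A = ⋃ n, (Iseq n).conc A) ∧ (∀ R, I.role R = ⋃ n, (Iseq n).role R)

/-- `I` is a canonical model of the annotated ontology `Ω`. -/
def IsCanMod [CommSemiring K] (Ω : Set (DLAxiom × K)) (I : Interp CD K) : Prop :=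
  ∃ Iseq : ℕ → Interp CD K, InitCan Ω (Iseq 0) ∧
    (∀ n, Iseq (n + 1) = Iseq n ∨ StepCan Ω (Iseq n) (Iseq (n + 1))) ∧
    IsLimitOf Iseq I ∧ ClosedCan Ω I

/-- The initial interpretation of the canonical model construction for a basic
concept `C` annotated with `κ`, with distinguished fresh element `dC`. -/
def InitCanC [CommSemiring K] (Ω : Set (DLAxiom × K)) (C : DLConcept) (κ : K)
    (dC : CD) (I : Interp CD K) : Prop :=
  I.indiv = Sum.inl ∧ dC ∉ Set.range (Sum.inl : ℕ → CD) ∧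
  match C with
  | .atom A =>
      I.dom = insert dC (Set.range (Sum.inl : ℕ → CD)) ∧
      (∀ B, B ≠ A → I.conc B = baseConc Ω B) ∧
      I.conc A = insert (dC, κ) (baseConc Ω A) ∧
      (∀ R, I.role R = baseRole Ω R)
  | .exis P .top =>
      ∃ df, df ∉ Set.range (Sum.inl : ℕ → CD) ∧ df ≠ dC ∧
        I.dom = insert dC (insert df (Set.range (Sum.inl : ℕ → CD))) ∧
        (∀ B, I.conc B = baseConc Ω B) ∧
        (∀ S, S ≠ (insRole P dC df κ).1 → I.role S = baseRole Ω S) ∧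
        I.role (insRole P dC df κ).1 =
          insert (insRole P dC df κ).2 (baseRole Ω (insRole P dC df κ).1)
  | _ => False

/-- `I` is a canonical model of the basic concept `C`, annotation `κ` and `Ω`. -/
def IsCanModC [CommSemiring K] (Ω : Set (DLAxiom × K)) (C : DLConcept) (κ : K)
    (dC : CD) (I : Interp CD K) : Prop :=
  ∃ Iseq : ℕ → Interp CD K, InitCanC Ω C κ dC (Iseq 0) ∧
    (∀ n, Iseq (n + 1) = Iseq n ∨ StepCan Ω (Iseq n) (Iseq (n + 1))) ∧
    IsLimitOf Iseq I ∧ ClosedCan Ω I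


theorem tvalN_var (σ : ℕ → ℕ) (v : ℕ) : tvalN σ (.var v) = σ v := rfl

/-- The fresh variable counter of `qCt` never decreases. -/
theorem le_qCt_snd (C : DLConcept) (t : DLTerm) (n : ℕ) : n ≤ (qCt C t n).2 := by
  induction C generalizing t n with
  | top => exact le_rfl
  | bot => exact le_rfl
  | atom B => exact le_rfl
  | inter C₁ C₂ ih₁ ih₂ => exact (ih₁ t n).trans (ih₂ t _)
  | exis P C ih =>
    cases P <;> exact (Nat.le_succ n).trans (ih (.var n) (n + 1))

/-- Whether an atom of an instance query is matched, and its value, depend only on the value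
of the head term and of the variables introduced by the query. -/
theorem qCt_congr [CommSemiring K] (D : Finset DLAxiom) (lam : DLAxiom → K) {σ τ : ℕ → ℕ}
    (C : DLConcept) (t : DLTerm) (n : ℕ) (ht : tvalN σ t = tvalN τ t)
    (h : ∀ v < (qCt C t n).2, σ v = τ v) :
    ∀ q ∈ (qCt C t n).1, (q.dbHolds D σ ↔ q.dbHolds D τ) ∧ q.dbVal lam σ = q.dbVal lam τ := by
  induction C generalizing t n with
  | top => simp [qCt, QAtom.dbHolds, QAtom.dbVal]
  | bot => simp [qCt, QAtom.dbHolds, QAtom.dbVal]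
  | atom B => simp [qCt, QAtom.dbHolds, QAtom.dbVal, ht]
  | inter C₁ C₂ ih₁ ih₂ =>
    intro q hq
    rcases List.mem_append.1 hq with hq | hq
    · exact ih₁ t n ht (fun v hv => h v (hv.trans_le (le_qCt_snd C₂ t _))) q hq
    · exact ih₂ t _ ht h q hq
  | exis P C ih =>
    have hle := le_qCt_snd C (.var n) (n + 1)
    cases P <;>
    · intro q hq
      have hn : σ n = τ n := h n hle
      rcases List.mem_cons.1 hq with rfl | hq
      · simp [QAtom.dbHolds, QAtom.dbVal, ht, tvalN_var, hn]
      · exact ih (.var n) (n + 1) hn h q hq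

theorem isDBMatch_congr {D : Finset DLAxiom} {σ τ : ℕ → ℕ} {q : BCQ}
    (h : ∀ x ∈ q, (x.dbHolds D σ ↔ x.dbHolds D τ)) : isDBMatch D σ q ↔ isDBMatch D τ q :=
  forall₂_congr h

theorem matchVal_congr [CommSemiring K] {lam : DLAxiom → K} {σ τ : ℕ → ℕ} {q : BCQ}
    (h : ∀ x ∈ q, x.dbVal lam σ = x.dbVal lam τ) : matchVal lam σ q = matchVal lam τ q :=
  congrArg List.prod (List.map_congr_left h)

/-- Every database match of an instance query witnesses membership in the concept extension,
in every interpretation satisfying the annotated assertions. -/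
theorem mem_interp_of_isDBMatch [CommSemiring K] {D : Finset DLAxiom} {lam : DLAxiom → K}
    {I : Interp Δ K} (hI : isModel I (toAnn D lam)) {σ : ℕ → ℕ}
    (C : DLConcept) (hC : C.botFree) (t : DLTerm) (n : ℕ)
    (h : isDBMatch D σ (qCt C t n).1) :
    (I.indiv (tvalN σ t), matchVal lam σ (qCt C t n).1) ∈ C.interp I := by
  induction C generalizing t n with
  | top => exact ⟨I.indiv_mem _, by simp [qCt, matchVal, QAtom.dbVal]⟩
  | bot => exact hC.elim
  | atom B =>
    have hB : DLAxiom.cassert B (tvalN σ t) ∈ D := h (.conc B t) (by simp [qCt])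
    have := hI (_, lam _) ⟨hB, rfl⟩
    simpa [qCt, matchVal, QAtom.dbVal, DLConcept.interp, Interp.satA] using this
  | inter C₁ C₂ ih₁ ih₂ =>
    refine ⟨_, _, _, ih₁ hC.1 t n fun q hq => h q (List.mem_append_left _ hq),
      ih₂ hC.2 t _ fun q hq => h q (List.mem_append_right _ hq), ?_⟩
    simp [qCt, matchVal]
  | exis P C ih =>
    cases P with
    | name R =>
      have hR : DLAxiom.rassert R (tvalN σ t) (σ n) ∈ D := h _ List.mem_cons_self
      refine ⟨_, _, _, _, hI (_, lam _) ⟨hR, rfl⟩,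
        ih hC (.var n) (n + 1) fun q hq => h q (List.mem_cons_of_mem _ hq), ?_⟩
      simp [qCt, matchVal, QAtom.dbVal, tvalN]
    | inv R =>
      have hR : DLAxiom.rassert R (σ n) (tvalN σ t) ∈ D := h _ List.mem_cons_self
      refine ⟨_, _, _, _, hI (_, lam _) ⟨hR, rfl⟩,
        ih hC (.var n) (n + 1) fun q hq => h q (List.mem_cons_of_mem _ hq), ?_⟩
      simp [qCt, matchVal, QAtom.dbVal, tvalN]

/-- The interpretation on the individual names given by the annotated assertions. -/
def dbInterp (D : Finset DLAxiom) (lam : DLAxiom → K) : Interp ℕ K where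
  dom := Set.univ
  dom_nonempty := Set.univ_nonempty
  indiv := id
  indiv_mem _ := Set.mem_univ _
  conc B := {p | DLAxiom.cassert B p.1 ∈ D ∧ p.2 = lam (.cassert B p.1)}
  conc_mem _ _ _ := Set.mem_univ _
  role R := {p | DLAxiom.rassert R p.1 p.2.1 ∈ D ∧ p.2.2 = lam (.rassert R p.1 p.2.1)}
  role_mem _ _ _ := ⟨Set.mem_univ _, Set.mem_univ _⟩

/-- Membership in a concept extension of `dbInterp` is witnessed by a database match of the
instance query, which may be chosen to extend a given assignment of the older variables. -/
theorem exists_isDBMatch_of_mem_interp [CommSemiring K] {D : Finset DLAxiom}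
    {lam : DLAxiom → K} (C : DLConcept) (t : DLTerm) (n : ℕ) (σ : ℕ → ℕ)
    (ht : ∀ τ : ℕ → ℕ, (∀ v < n, τ v = σ v) → tvalN τ t = tvalN σ t) (κ : K)
    (h : (tvalN σ t, κ) ∈ C.interp (dbInterp D lam)) :
    ∃ τ : ℕ → ℕ, (∀ v < n, τ v = σ v) ∧ isDBMatch D τ (qCt C t n).1 ∧
      matchVal lam τ (qCt C t n).1 = κ := by
  induction C generalizing t n σ κ with
  | top =>
    refine ⟨σ, fun _ _ => rfl, ?_, ?_⟩
    · simp [isDBMatch, qCt, QAtom.dbHolds]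
    · simpa [matchVal, qCt, QAtom.dbVal] using h.2.symm
  | bot => exact h.elim
  | atom B =>
    refine ⟨σ, fun _ _ => rfl, ?_, ?_⟩
    · simpa [isDBMatch, qCt, QAtom.dbHolds] using h.1
    · simpa [matchVal, qCt, QAtom.dbVal] using h.2.symm
  | inter C₁ C₂ ih₁ ih₂ =>
    obtain ⟨d, κ₁, κ₂, h₁, h₂, he⟩ := h
    obtain ⟨rfl, rfl⟩ := Prod.mk.inj he
    obtain ⟨τ₁, e₁, m₁, v₁⟩ := ih₁ t n σ ht κ₁ h₁
    have hle := le_qCt_snd C₁ t n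
    have ht₁ := ht τ₁ e₁
    obtain ⟨τ₂, e₂, m₂, v₂⟩ := ih₂ t (qCt C₁ t n).2 τ₁
      (fun τ hτ => by
        rw [ht₁]
        exact ht τ fun v hv => (hτ v (hv.trans_le hle)).trans (e₁ v hv))
      κ₂ (ht₁.symm ▸ h₂)
    have e : ∀ v < n, τ₂ v = σ v := fun v hv => (e₂ v (hv.trans_le hle)).trans (e₁ v hv)
    have hc := qCt_congr D lam C₁ t n ((ht τ₂ e).trans ht₁.symm) e₂
    refine ⟨τ₂, e, ?_, ?_⟩
    · have m₁' := (isDBMatch_congr fun q hq => (hc q hq).1).2 m₁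
      intro q hq
      exact (List.mem_append.1 hq).elim (m₁' q) (m₂ q)
    · have v₁' := (matchVal_congr fun q hq => (hc q hq).2).trans v₁
      simp only [matchVal] at v₁' v₂
      simp [qCt, matchVal, v₁', v₂]
  | exis P C ih =>
    obtain ⟨d, e, κ₁, κ₂, hP, h₂, he⟩ := h
    obtain ⟨rfl, rfl⟩ := Prod.mk.inj he
    have hσ : ∀ v < n, Function.update σ n e v = σ v := fun v hv =>
      Function.update_of_ne hv.ne _ _
    obtain ⟨τ, eτ, m, v⟩ := ih (.var n) (n + 1) (Function.update σ n e)
      (fun τ hτ => hτ n n.lt_succ_self) κ₂ (by simpa [tvalN] using h₂)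
    have eσ : ∀ v < n, τ v = σ v := fun v hv =>
      (eτ v (hv.trans n.lt_succ_self)).trans (hσ v hv)
    have hn : τ n = e := by simpa using eτ n n.lt_succ_self
    have htτ := ht τ eσ
    simp only [matchVal] at v
    cases P <;>
    · refine ⟨τ, eσ, ?_, ?_⟩
      · intro q hq
        rcases List.mem_cons.1 hq with rfl | hq
        · simpa [QAtom.dbHolds, htτ, tvalN_var, hn] using hP.1
        · exact m q hq
      · have hv := hP.2
        dsimp only at hv
        simp [qCt, matchVal, v, QAtom.dbVal, htτ, tvalN_var, hn, hv]

/-- Two interpretations with the same domain and roles agree on concepts built from concept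
names on which they agree. -/
theorem interp_congr [CommSemiring K] {I J : Interp Δ K} (hdom : I.dom = J.dom)
    (hrole : I.role = J.role) (C : DLConcept) (h : ∀ B ∈ C.concNames, I.conc B = J.conc B) :
    C.interp I = C.interp J := by
  induction C with
  | top => simp [DLConcept.interp, hdom]
  | bot => rfl
  | atom B => exact h B (Finset.mem_singleton_self B)
  | inter C₁ C₂ ih₁ ih₂ =>
    simp only [DLConcept.interp]
    rw [ih₁ fun B hB => h B (Finset.mem_union_left _ hB),
      ih₂ fun B hB => h B (Finset.mem_union_right _ hB)]
  | exis P C ih =>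
    have hP : P.interp I = P.interp J := by cases P <;> simp [DLRole.interp, hrole]
    simp only [DLConcept.interp]
    rw [ih h, hP]

/-- The extension of `dbInterp` which adds to the concept name `A` the extensions of the
concepts in `Cs`. -/
def dbInterpWith [CommSemiring K] (D : Finset DLAxiom) (lam : DLAxiom → K) (A : ℕ)
    (Cs : Finset DLConcept) : Interp ℕ K :=
  { dbInterp D lam with
    conc := fun B => (dbInterp D lam).conc B ∪
      {p | B = A ∧ ∃ C ∈ Cs, p ∈ C.interp (dbInterp D lam)}
    conc_mem := fun _ _ _ => Set.mem_univ _ }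

theorem interp_dbInterpWith [CommSemiring K] (D : Finset DLAxiom) (lam : DLAxiom → K) {A : ℕ}
    (Cs : Finset DLConcept) {C : DLConcept} (hA : A ∉ C.concNames) :
    C.interp (dbInterpWith D lam A Cs) = C.interp (dbInterp D lam) :=
  interp_congr (I := dbInterpWith D lam A Cs) (J := dbInterp D lam) rfl rfl C fun B hB => by
    have hBA : B ≠ A := fun h => hA (h ▸ hB)
    simp [dbInterpWith, hBA]

/-- For an additively idempotent ω-continuous commutative semiring,
a database D of annotated assertions and GCIs (C_i ⊑ A, 1) where A does not occur in
the ELHI concepts C_i: the provenance of A(a) is the sum of the annotation of A(a) in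
D (if present) and of the products of annotations over the database matches of the
instance queries q_{C_i}(a). -/
theorem statement11 {K : Type} [OmegaCS K] (hadd : ∀ κ : K, κ + κ = κ)
    (D : Finset DLAxiom) (lam : DLAxiom → K)
    (hD : ∀ α ∈ D, α.isAssertion) (hnz : ∀ α ∈ D, lam α ≠ 0)
    (A : ℕ) (Cs : Finset DLConcept) (hCs : ∀ C ∈ Cs, C.botFree ∧ A ∉ C.concNames)
    (a : ℕ) :
    prov
      (toAnn (D ∪ Cs.image fun C => DLAxiom.gci C (DLConcept.atom A))
        (fun α => match α with
          | DLAxiom.gci _ _ => (1 : K)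
          | β => lam β))
      (DLStmt.ax (DLAxiom.cassert A a)) =
    OmegaCS.setSum
      {κ | (DLAxiom.cassert A a ∈ D ∧ κ = lam (DLAxiom.cassert A a)) ∨
           ∃ C ∈ Cs, ∃ σ : ℕ → ℕ, isDBMatch D σ (qCa C a) ∧ matchVal lam σ (qCa C a) = κ} := by
  refine congrArg OmegaCS.setSum (Set.ext fun κ => ?_)
  constructor
  · intro h
    have hA := h ℕ (dbInterpWith D lam A Cs) (by
      rintro ⟨α, κ'⟩ ⟨hα, hκ⟩
      dsimp only at hα hκ
      subst hκ
      rcases Finset.mem_union.1 hα with hα | hα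
      · have hass := hD α hα
        cases α with
        | cassert B b => exact Or.inl ⟨hα, rfl⟩
        | rassert R b c => exact ⟨hα, rfl⟩
        | roleInc P Q => exact hass.elim
        | roleDisj P Q => exact hass.elim
        | gci C E => exact hass.elim
      · obtain ⟨C, hC, rfl⟩ := Finset.mem_image.1 hα
        intro d κ' hd
        rw [interp_dbInterpWith D lam Cs (hCs C hC).2] at hd
        rw [one_mul]
        exact Or.inr ⟨rfl, C, hC, hd⟩)
    rcases hA with hA | ⟨-, C, hC, hd⟩
    · exact Or.inl hA
    · obtain ⟨τ, -, hm, hv⟩ :=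
        exists_isDBMatch_of_mem_interp C (.ind a) 0 id (fun _ _ => rfl) κ hd
      exact Or.inr ⟨C, hC, τ, hm, hv⟩
  · rintro (⟨hA, rfl⟩ | ⟨C, hC, σ, hm, rfl⟩) Δ I hI
    · exact hI (_, lam _) ⟨Finset.mem_union_left _ hA, rfl⟩
    · have hI' : isModel I (toAnn D lam) := by
        rintro ⟨α, κ'⟩ ⟨hα, hκ⟩
        obtain rfl : κ' = lam α := hκ
        have hass := hD α hα
        cases α with
        | gci C E => exact hass.elim
        | _ => exact hI (_, lam _) ⟨Finset.mem_union_left _ hα, rfl⟩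
      have hd := mem_interp_of_isDBMatch hI' C (hCs C hC).1 (.ind a) 0 hm
      have hg := hI (DLAxiom.gci C (.atom A), 1)
        ⟨Finset.mem_union_right _ (Finset.mem_image_of_mem _ hC), rfl⟩ _ _ hd
      rw [one_mul] at hg
      exact hg

end DLProv
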